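/- arXiv:2210.01348 — 13 statements merged into one kernel-verified Lean document; each statement's English description precedes it below -/
import Mathlib

section
/- Let φ, φ̃ : ℝ → ℝ be differentiable, strictly increasing functions with 0 < φ(z) < 1 and 0 < φ̃(z) < 1 for all z, with φ(z) → 0, φ̃(z) → 0 as z → −∞ and φ(z) → 1, φ̃(z) → 1 as z → ∞, and with φ′(z) > 0 and φ̃′(z) > 0 for all z (so each is a bijection from ℝ onto (0,1)). Assume: (a) for every a > 0, (1 − φ(z))/(1 − φ̃(a·z)) → 0 as z → ∞, and (b) there exists z₁ such that the composite φ̃⁻¹ ∘ φ is convex on (z₁, ∞), where φ̃⁻¹ : (0,1) → ℝ is the inverse of φ̃. Then g_φ(f)/g_φ̃(f) → ∞ as f → 1 from below, where g_φ(f) := φ′(φ⁻¹(f)) and g_φ̃(f) := φ̃′(φ̃⁻¹(f)). -/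
open Filter

/-- A differentiable strictly increasing function with range `Ioo 0 1` and positive derivative has
a differentiable inverse on `Ioo 0 1`. -/
theorem hasDerivAt_inverse_of_strictMono {ψ ψinv : ℝ → ℝ} (hdiff : Differentiable ℝ ψ)
    (hmono : StrictMono ψ) (h01 : ∀ z, ψ z ∈ Set.Ioo (0 : ℝ) 1)
    (hpos : ∀ z, 0 < deriv ψ z) (hleft : ∀ z, ψinv (ψ z) = z)
    (hright : ∀ f ∈ Set.Ioo (0 : ℝ) 1, ψ (ψinv f) = f) {f : ℝ} (hf : f ∈ Set.Ioo (0 : ℝ) 1) :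
    HasDerivAt ψinv (deriv ψ (ψinv f))⁻¹ f := by
  have hnhds : Set.Ioo (0 : ℝ) 1 ∈ nhds f := isOpen_Ioo.mem_nhds hf
  have hinvmono : StrictMonoOn ψinv (Set.Ioo 0 1) := fun x hx y hy hxy => by
    rwa [← hmono.lt_iff_lt, hright x hx, hright y hy]
  have himage : ψinv '' Set.Ioo 0 1 = Set.univ :=
    Set.eq_univ_of_forall fun z => ⟨ψ z, h01 z, hleft z⟩
  have hcont : ContinuousAt ψinv f :=
    hinvmono.continuousAt_of_image_mem_nhds hnhds (by rw [himage]; exact univ_mem)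
  exact (hdiff (ψinv f)).hasDerivAt.of_local_left_inverse hcont (hpos _).ne'
    (eventually_of_mem hnhds hright)

/-- Theorem 1: if φ has a higher order of saturation than φ̃, then the ratio of the
learning-speed functions g_φ(f)/g_φ̃(f) tends to infinity as f → 1 from below. -/
theorem higher_order_saturation_accelerates_learning
    (φ φt φinv φtinv : ℝ → ℝ)
    (hφdiff : Differentiable ℝ φ) (hφtdiff : Differentiable ℝ φt)
    (hφmono : StrictMono φ) (hφtmono : StrictMono φt)
    (hφ01 : ∀ z, φ z ∈ Set.Ioo (0 : ℝ) 1) (hφt01 : ∀ z, φt z ∈ Set.Ioo (0 : ℝ) 1)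
    (hφbot : Tendsto φ atBot (nhds 0)) (hφtop : Tendsto φ atTop (nhds 1))
    (hφtbot : Tendsto φt atBot (nhds 0)) (hφttop : Tendsto φt atTop (nhds 1))
    (hφ' : ∀ z, 0 < deriv φ z) (hφt' : ∀ z, 0 < deriv φt z)
    (hφinv : ∀ z, φinv (φ z) = z)
    (hφinv' : ∀ f ∈ Set.Ioo (0 : ℝ) 1, φ (φinv f) = f)
    (hφtinv : ∀ z, φtinv (φt z) = z)
    (hφtinv' : ∀ f ∈ Set.Ioo (0 : ℝ) 1, φt (φtinv f) = f)
    (horder : ∀ a > (0 : ℝ),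
      Tendsto (fun z => (1 - φ z) / (1 - φt (a * z))) atTop (nhds 0))
    (hconv : ∃ z₁ : ℝ, ConvexOn ℝ (Set.Ioi z₁) (fun z => φtinv (φ z))) :
    Tendsto (fun f => deriv φ (φinv f) / deriv φt (φtinv f))
      (nhdsWithin 1 (Set.Ioo (0 : ℝ) 1)) atTop := by
  obtain ⟨z₁, hconv⟩ := hconv
  have hsuper : ∀ a > (0 : ℝ), ∀ᶠ z in atTop, a * z < φtinv (φ z) := fun a ha => by
    filter_upwards [(horder a ha).eventually_lt_const zero_lt_one] with z hz
    rw [div_lt_one (by linarith [(hφt01 (a * z)).2])] at hz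
    rw [← hφtmono.lt_iff_lt, hφtinv' _ (hφ01 z)]
    linarith
  have hderiv : ∀ z, HasDerivAt (fun z => φtinv (φ z))
      (deriv φ z / deriv φt (φtinv (φ z))) z := fun z => by
    have := (hasDerivAt_inverse_of_strictMono hφtdiff hφtmono hφt01 hφt' hφtinv hφtinv'
      (hφ01 z)).comp z (hφdiff z).hasDerivAt
    rwa [inv_mul_eq_div] at this
  have hratio : Tendsto (fun z => deriv φ z / deriv φt (φtinv (φ z))) atTop atTop := by
    refine tendsto_atTop.2 fun M => ?_
    set z₀ := z₁ + 1 with hz₀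
    filter_upwards [hsuper (|M| + 1) (by positivity), eventually_gt_atTop z₀,
      eventually_ge_atTop 0, eventually_ge_atTop (φtinv (φ z₀) - M * z₀)] with z hz hz₀z hz0 hzM
    refine le_trans ?_ (hconv.slope_le_of_hasDerivAt (x := z₀) (y := z)
      (Set.mem_Ioi.2 (by linarith)) (Set.mem_Ioi.2 (by linarith)) hz₀z (hderiv z))
    rw [slope_def_field, le_div_iff₀ (by linarith)]
    nlinarith [mul_le_mul_of_nonneg_right (le_abs_self M) hz0]
  have hinvtop : Tendsto φinv (nhdsWithin 1 (Set.Ioo (0 : ℝ) 1)) atTop := by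
    refine tendsto_atTop.2 fun Z => ?_
    filter_upwards [self_mem_nhdsWithin,
      mem_nhdsWithin_of_mem_nhds (Ioi_mem_nhds (hφ01 Z).2)] with f hf hZ
    rw [← hφmono.le_iff_le, hφinv' f hf]
    exact hZ.le
  refine (hratio.comp hinvtop).congr' ?_
  filter_upwards [self_mem_nhdsWithin] with f hf
  simp only [Function.comp_apply, hφinv' f hf]
end

section
/- Let φ, φ̃ : ℝ → ℝ be differentiable, strictly increasing functions with 0 < φ(z) < 1 and 0 < φ̃(z) < 1 for all z, with φ(z) → 1 and φ̃(z) → 1 as z → ∞, and with φ̃′(z) > 0 for all z, so that φ̃ is a bijection onto (0,1) with inverse φ̃⁻¹. Assume that for every a > 0, (1 − φ(z))/(1 − φ̃(a·z)) → 0 as z → ∞, and that there exists z₁ such that η := φ̃⁻¹ ∘ φ is convex on (z₁, ∞). Then for every a > 0 there exists Z such that η′(z) ≥ a for all z ≥ Z. -/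
open Filter

/-- The inverse, on an open interval, of a differentiable, strictly increasing function with
non-vanishing derivative is differentiable there. -/
lemma differentiableAt_of_strictMono_inverse {f g : ℝ → ℝ} {l u : ℝ}
    (hf : Differentiable ℝ f) (hmono : StrictMono f) (hlu : ∀ z, f z ∈ Set.Ioo l u)
    (hf' : ∀ z, deriv f z ≠ 0) (hgf : ∀ z, g (f z) = z)
    (hfg : ∀ y ∈ Set.Ioo l u, f (g y) = y) {y : ℝ} (hy : y ∈ Set.Ioo l u) :
    DifferentiableAt ℝ g y := by
  have hnhds : Set.Ioo l u ∈ nhds y := isOpen_Ioo.mem_nhds hy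
  have hgmono : StrictMonoOn g (Set.Ioo l u) := fun v hv w hw hvw =>
    hmono.lt_iff_lt.mp (by rwa [hfg v hv, hfg w hw])
  have himage : g '' Set.Ioo l u = Set.univ :=
    Set.eq_univ_of_forall fun z => ⟨f z, hlu z, hgf z⟩
  have hcont : ContinuousAt g y :=
    hgmono.continuousAt_of_image_mem_nhds hnhds (himage ▸ univ_mem)
  exact ((hf (g y)).hasDerivAt.of_local_left_inverse hcont (hf' _)
    (eventually_of_mem hnhds hfg)).differentiableAt

/-- A convex function that eventually exceeds a line of slope `2 * a` has derivative eventually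
at least `a`. -/
lemma eventually_le_deriv_of_convexOn {f : ℝ → ℝ} {z₁ a : ℝ} (ha : 0 < a)
    (hconv : ConvexOn ℝ (Set.Ioi z₁) f) (hf : Differentiable ℝ f)
    (hlarge : ∀ᶠ z in atTop, 2 * a * z < f z) :
    ∀ᶠ z in atTop, a ≤ deriv f z := by
  have hbase : z₁ + 1 ∈ Set.Ioi z₁ := lt_add_one z₁
  filter_upwards [hlarge, eventually_gt_atTop (z₁ + 1),
    eventually_ge_atTop (f (z₁ + 1) / a - (z₁ + 1))] with z hz hz₁ hza
  refine le_trans ?_ (hconv.slope_le_deriv hbase (hbase.trans hz₁) hz₁ (hf z))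
  rw [slope_def_field, le_div_iff₀ (sub_pos.mpr hz₁)]
  rw [sub_le_iff_le_add, div_le_iff₀ ha] at hza
  linarith

/-- Key lemma for Theorem 1: a higher order of saturation forces the derivative of
η = φ̃⁻¹ ∘ φ to eventually exceed any prescribed constant. -/
theorem eta_deriv_eventually_large
    (φ φt φtinv : ℝ → ℝ)
    (hφdiff : Differentiable ℝ φ) (hφtdiff : Differentiable ℝ φt)
    (hφmono : StrictMono φ) (hφtmono : StrictMono φt)
    (hφ01 : ∀ z, φ z ∈ Set.Ioo (0 : ℝ) 1) (hφt01 : ∀ z, φt z ∈ Set.Ioo (0 : ℝ) 1)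
    (hφtop : Tendsto φ atTop (nhds 1)) (hφttop : Tendsto φt atTop (nhds 1))
    (hφt' : ∀ z, 0 < deriv φt z)
    (hφtinv : ∀ z, φtinv (φt z) = z)
    (hφtinv' : ∀ f ∈ Set.Ioo (0 : ℝ) 1, φt (φtinv f) = f)
    (horder : ∀ a > (0 : ℝ),
      Tendsto (fun z => (1 - φ z) / (1 - φt (a * z))) atTop (nhds 0))
    (z₁ : ℝ) (hconv : ConvexOn ℝ (Set.Ioi z₁) (fun z => φtinv (φ z))) :
    ∀ a > (0 : ℝ), ∃ Z : ℝ, ∀ z ≥ Z, a ≤ deriv (fun z => φtinv (φ z)) z := by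
  intro a ha
  have hdiff : Differentiable ℝ fun z => φtinv (φ z) := fun z =>
    (differentiableAt_of_strictMono_inverse hφtdiff hφtmono hφt01 (fun z => (hφt' z).ne')
      hφtinv hφtinv' (hφ01 z)).comp z (hφdiff z)
  have hlarge : ∀ᶠ z in atTop, 2 * a * z < φtinv (φ z) := by
    filter_upwards [(horder (2 * a) (by positivity)).eventually_lt_const one_pos] with z hz
    rw [div_lt_one (sub_pos.mpr (hφt01 _).2)] at hz
    rw [← hφtmono.lt_iff_lt, hφtinv' _ (hφ01 z)]
    linarith
  exact eventually_atTop.mp (eventually_le_deriv_of_convexOn ha hconv hdiff hlarge)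
end

section
/- Let T be a positive integer, τ₀ ∈ ℝ, and let f : ℝ → ℝ be differentiable on [τ₀, ∞) with 0 < f(τ₀) < 1 and f′(τ) = T · f(τ)^{T+1} · (1 − f(τ))² for all τ ≥ τ₀. Then 0 < f(τ) < 1 for all τ ≥ τ₀, f is nondecreasing on [τ₀, ∞), and there exist a constant C > 0 and τ₁ ≥ τ₀ such that 1 − f(τ) ≤ C/τ for all τ ≥ τ₁. -/
open Set in
/-- A solution of the linear equation `g' = a g` with continuous coefficient that starts positive
stays positive. -/
theorem pos_of_hasDerivAt_mul_self {a g : ℝ → ℝ} {t₀ : ℝ} (ha : ContinuousOn a (Ici t₀))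
    (hg : ∀ t ≥ t₀, HasDerivAt g (a t * g t) t) (h₀ : 0 < g t₀) :
    ∀ t ≥ t₀, 0 < g t := by
  intro t ht
  have hb : Continuous fun s => a (max t₀ s) :=
    ha.comp_continuous (by fun_prop) fun s => mem_Ici.2 (le_max_left _ _)
  set A : ℝ → ℝ := fun s => ∫ x in t₀..s, a (max t₀ x)
  have hA : ∀ s ≥ t₀, HasDerivAt A (a s) s := fun s hs => by
    simpa [max_eq_right hs] using hb.integral_hasStrictDerivAt t₀ s |>.hasDerivAt
  have hd : ∀ s ≥ t₀, HasDerivAt (fun x => g x * Real.exp (-A x)) 0 s := fun s hs =>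
    ((hg s hs).mul (hA s hs).neg.exp).congr_deriv (by simp only [Pi.neg_apply]; ring)
  have hconst := constant_of_has_deriv_right_zero (a := t₀) (b := t)
    (fun s hs => (hd s hs.1).continuousAt.continuousWithinAt)
    (fun s hs => (hd s hs.1).hasDerivWithinAt) t ⟨ht, le_rfl⟩
  have hpos : 0 < g t * Real.exp (-A t) := by
    rw [hconst]
    exact mul_pos h₀ (Real.exp_pos _)
  exact pos_of_mul_pos_left hpos (Real.exp_pos _).le

open Set in
/-- A function with nonnegative derivative on `[t₀, ∞)` is monotone there. -/
theorem monotoneOn_Ici_of_hasDerivAt_nonneg {g g' : ℝ → ℝ} {t₀ : ℝ}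
    (hg : ∀ t ≥ t₀, HasDerivAt g (g' t) t) (h : ∀ t ≥ t₀, 0 ≤ g' t) :
    MonotoneOn g (Ici t₀) :=
  monotoneOn_of_hasDerivWithinAt_nonneg (convex_Ici t₀)
    (fun t ht => (hg t ht).continuousAt.continuousWithinAt)
    (fun t ht => (hg t (interior_subset ht)).hasDerivWithinAt)
    (fun t ht => h t (interior_subset ht))

/-- Proposition 2 (sigmoid gate): the gradient flow f' = T f^{T+1} (1-f)^2 stays in (0,1),
is nondecreasing, and satisfies 1 - f(τ) = O(τ⁻¹). -/
theorem sigmoid_gate_convergence_rate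
    (T : ℕ) (hT : 0 < T) (τ₀ : ℝ) (f : ℝ → ℝ)
    (hf₀ : 0 < f τ₀ ∧ f τ₀ < 1)
    (hode : ∀ τ ≥ τ₀,
      HasDerivAt f ((T : ℝ) * f τ ^ (T + 1) * (1 - f τ) ^ 2) τ) :
    (∀ τ ≥ τ₀, 0 < f τ ∧ f τ < 1) ∧
    MonotoneOn f (Set.Ici τ₀) ∧
    ∃ C > (0 : ℝ), ∃ τ₁ ≥ τ₀, ∀ τ ≥ τ₁, 1 - f τ ≤ C / τ := by
  have hfc : ContinuousOn f (Set.Ici τ₀) := fun τ hτ =>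
    (hode τ hτ).continuousAt.continuousWithinAt
  have hpos : ∀ τ ≥ τ₀, 0 < f τ :=
    pos_of_hasDerivAt_mul_self (a := fun τ => T * f τ ^ T * (1 - f τ) ^ 2) (by fun_prop)
      (fun τ hτ => (hode τ hτ).congr_deriv (by ring)) hf₀.1
  have hlt : ∀ τ ≥ τ₀, 0 < 1 - f τ :=
    pos_of_hasDerivAt_mul_self (g := fun τ => 1 - f τ)
      (a := fun τ => -(T * f τ ^ (T + 1) * (1 - f τ))) (by fun_prop)
      (fun τ hτ => ((hode τ hτ).const_sub 1).congr_deriv (by ring)) (sub_pos.2 hf₀.2)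
  have hmono : MonotoneOn f (Set.Ici τ₀) :=
    monotoneOn_Ici_of_hasDerivAt_nonneg hode fun τ hτ => by
      have := hpos τ hτ
      positivity
  refine ⟨fun τ hτ => ⟨hpos τ hτ, sub_pos.1 (hlt τ hτ)⟩, hmono, ?_⟩
  have hT' : (0 : ℝ) < T := by exact_mod_cast hT
  set c : ℝ := T * f τ₀ ^ (T + 1)
  have hc : 0 < c := mul_pos hT' (pow_pos hf₀.1 _)
  have hinv : MonotoneOn (fun τ => (1 - f τ)⁻¹ - c * τ) (Set.Ici τ₀) := by
    refine monotoneOn_Ici_of_hasDerivAt_nonneg (g' := fun τ => T * f τ ^ (T + 1) - c)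
      (fun τ hτ => ?_) fun τ hτ => ?_
    · have hne := (hlt τ hτ).ne'
      refine ((((hode τ hτ).const_sub 1).inv hne).sub
        ((hasDerivAt_id τ).const_mul c)).congr_deriv ?_
      field_simp
    · exact sub_nonneg.2 (mul_le_mul_of_nonneg_left
        (pow_le_pow_left₀ hf₀.1.le (hmono Set.self_mem_Ici hτ hτ) _) hT'.le)
  refine ⟨2 / c, by positivity, max τ₀ (max (2 * τ₀) 1), le_max_left _ _, fun τ hτ => ?_⟩
  obtain ⟨h₁, h₂, h₃⟩ : τ₀ ≤ τ ∧ 2 * τ₀ ≤ τ ∧ 1 ≤ τ := by simpa using hτ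
  have hle : (1 - f τ₀)⁻¹ - c * τ₀ ≤ (1 - f τ)⁻¹ - c * τ := hinv Set.self_mem_Ici h₁ h₁
  have h₀ : 0 < (1 - f τ₀)⁻¹ := inv_pos.2 (hlt τ₀ le_rfl)
  have hτ₀ : 0 < τ := by linarith
  have hlow : c * τ / 2 ≤ (1 - f τ)⁻¹ := by nlinarith
  calc 1 - f τ ≤ (c * τ / 2)⁻¹ := (le_inv_comm₀ (by positivity) (hlt τ h₁)).1 hlow
    _ = 2 / c / τ := by field_simp
end

section
/- Let T be a positive integer, τ₀ ∈ ℝ, and let f : ℝ → ℝ be differentiable on [τ₀, ∞) with 0 < f(τ₀) < 1 and f′(τ) = T · f(τ)^{T+1} · (1 − f(τ))² for all τ ≥ τ₀. Then there exist a constant c > 0 and τ₁ ≥ τ₀ such that 1 − f(τ) ≥ c/τ for all τ ≥ τ₁. -/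
/-- A solution of the sigmoid-gate flow never drops below its initial value. -/
theorem le_of_sigmoid_gate_flow {T : ℕ} (hT : 0 < T) {τ₀ : ℝ} {f : ℝ → ℝ}
    (hf₀ : 0 < f τ₀ ∧ f τ₀ < 1)
    (hode : ∀ τ ≥ τ₀, HasDerivAt f ((T : ℝ) * f τ ^ (T + 1) * (1 - f τ) ^ 2) τ)
    {τ : ℝ} (hτ : τ₀ ≤ τ) : f τ₀ ≤ f τ := by
  obtain ⟨hpos, hlt⟩ := hf₀
  have hT' : (0 : ℝ) < T := Nat.cast_pos.2 hT
  have key := image_le_of_deriv_right_lt_deriv_boundary (f := fun x => -f x)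
    (f' := fun x => -((T : ℝ) * f x ^ (T + 1) * (1 - f x) ^ 2))
    (a := τ₀) (b := τ) (B := fun _ => -f τ₀) (B' := fun _ => 0)
    (fun x hx => (hode x hx.1).neg.continuousAt.continuousWithinAt)
    (fun x hx => (hode x hx.1).neg.hasDerivWithinAt) le_rfl
    (fun x => hasDerivAt_const x _)
    (fun x _ hx => by
      have hfx : f x = f τ₀ := neg_injective hx
      have h1 : 0 < 1 - f τ₀ := sub_pos.2 hlt
      rw [hfx, neg_lt_zero]
      positivity)
  exact neg_le_neg_iff.1 (key ⟨hτ, le_rfl⟩)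

/-- A solution of the sigmoid-gate flow stays below the solution of `g' = T (1 - g) ^ 2`
with the same initial value. -/
theorem sigmoid_gate_flow_le {T : ℕ} (hT : 0 < T) {τ₀ : ℝ} {f : ℝ → ℝ}
    (hf₀ : 0 < f τ₀ ∧ f τ₀ < 1)
    (hode : ∀ τ ≥ τ₀, HasDerivAt f ((T : ℝ) * f τ ^ (T + 1) * (1 - f τ) ^ 2) τ)
    {τ : ℝ} (hτ : τ₀ ≤ τ) : f τ ≤ 1 - (T * (τ - τ₀) + (1 - f τ₀)⁻¹)⁻¹ := by
  have hT' : (0 : ℝ) < T := Nat.cast_pos.2 hT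
  have hs : 0 < (1 - f τ₀)⁻¹ := inv_pos.2 (sub_pos.2 hf₀.2)
  have hD : ∀ x ≥ τ₀, 0 < T * (x - τ₀) + (1 - f τ₀)⁻¹ := fun x hx =>
    add_pos_of_nonneg_of_pos (mul_nonneg hT'.le (sub_nonneg.2 hx)) hs
  have hB : ∀ x ≥ τ₀, HasDerivAt (fun y => 1 - (T * (y - τ₀) + (1 - f τ₀)⁻¹)⁻¹)
      (T / (T * (x - τ₀) + (1 - f τ₀)⁻¹) ^ 2) x := fun x hx => by
    have h := (((((hasDerivAt_id x).sub_const τ₀).const_mul (T : ℝ)).add_const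
      (1 - f τ₀)⁻¹).fun_inv (hD x hx).ne').const_sub 1
    simpa [neg_div] using h
  refine image_le_of_deriv_right_lt_deriv_boundary' (a := τ₀) (b := τ)
    (fun x hx => (hode x hx.1).continuousAt.continuousWithinAt)
    (fun x hx => (hode x hx.1).hasDerivWithinAt) (by simp)
    (fun x hx => (hB x hx.1).continuousAt.continuousWithinAt)
    (fun x hx => (hB x hx.1).hasDerivWithinAt) ?_ ⟨hτ, le_rfl⟩
  intro x hx hfx
  have hDx := hD x hx.1
  have hfpos : 0 < f x := hf₀.1.trans_le (le_of_sigmoid_gate_flow hT hf₀ hode hx.1)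
  have h1 : 1 - f x = (T * (x - τ₀) + (1 - f τ₀)⁻¹)⁻¹ := by rw [hfx, sub_sub_cancel]
  have hflt : f x < 1 := sub_pos.1 (h1 ▸ inv_pos.2 hDx)
  have hpow : f x ^ (T + 1) < 1 := pow_lt_one₀ hfpos.le hflt T.succ_ne_zero
  rw [h1, inv_pow, ← div_eq_mul_inv]
  gcongr
  exact mul_lt_of_lt_one_right hT' hpow


/-- Tightness for the sigmoid gate: the gradient flow f' = T f^{T+1} (1-f)^2 satisfies
1 - f(τ) ≥ c/τ eventually. -/
theorem sigmoid_gate_rate_tightness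
    (T : ℕ) (hT : 0 < T) (τ₀ : ℝ) (f : ℝ → ℝ)
    (hf₀ : 0 < f τ₀ ∧ f τ₀ < 1)
    (hode : ∀ τ ≥ τ₀,
      HasDerivAt f ((T : ℝ) * f τ ^ (T + 1) * (1 - f τ) ^ 2) τ) :
    ∃ c > (0 : ℝ), ∃ τ₁ ≥ τ₀, ∀ τ ≥ τ₁, c / τ ≤ 1 - f τ := by
  have hT' : (0 : ℝ) < T := Nat.cast_pos.2 hT
  set k : ℝ := (1 - f τ₀)⁻¹ - T * τ₀ with hk
  refine ⟨(T + |k|)⁻¹, by positivity, max τ₀ 1, le_max_left _ _, fun τ hτ => ?_⟩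
  have hτ₀ : τ₀ ≤ τ := (le_max_left _ _).trans hτ
  have hτ1 : 1 ≤ τ := (le_max_right _ _).trans hτ
  have hD : 0 < T * (τ - τ₀) + (1 - f τ₀)⁻¹ :=
    add_pos_of_nonneg_of_pos (mul_nonneg hT'.le (sub_nonneg.2 hτ₀))
      (inv_pos.2 (sub_pos.2 hf₀.2))
  have hle : T * (τ - τ₀) + (1 - f τ₀)⁻¹ ≤ (T + |k|) * τ := by
    have h2 : |k| ≤ |k| * τ := le_mul_of_one_le_right (abs_nonneg k) hτ1
    linarith [le_abs_self k]
  calc (T + |k|)⁻¹ / τ = ((T + |k|) * τ)⁻¹ := by rw [mul_inv, div_eq_mul_inv]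
    _ ≤ (T * (τ - τ₀) + (1 - f τ₀)⁻¹)⁻¹ := inv_anti₀ hD hle
    _ ≤ 1 - f τ := le_sub_comm.1 (sigmoid_gate_flow_le hT hf₀ hode hτ₀)
end

section
/- Let T be a positive integer, τ₀ ∈ ℝ, and let f : ℝ → ℝ be differentiable on [τ₀, ∞) with 0 < f(τ₀) < 1 and f′(τ) = T · f(τ)^{T} · (1 − f(τ))⁴ for all τ ≥ τ₀. Then there exist a constant c > 0 and τ₁ ≥ τ₀ such that 1 − f(τ) ≥ c·τ^{−1/3} for all τ ≥ τ₁. -/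
/-- A solution of a linear homogeneous ODE with continuous coefficient which is positive at the
initial time stays positive. -/
theorem pos_of_hasDerivAt_mul_self_s6 {y a : ℝ → ℝ} {t₀ : ℝ} (h₀ : 0 < y t₀)
    (ha : ContinuousOn a (Set.Ici t₀))
    (hy : ∀ t ≥ t₀, HasDerivAt y (a t * y t) t) {t : ℝ} (ht : t₀ ≤ t) : 0 < y t := by
  set b : ℝ → ℝ := fun s => a (max s t₀)
  have hb : Continuous b :=
    ha.comp_continuous (by fun_prop) fun s => le_max_right s t₀
  set A : ℝ → ℝ := fun s => ∫ r in t₀..s, b r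
  have hA (s : ℝ) : HasDerivAt A (b s) s := (hb.integral_hasStrictDerivAt t₀ s).hasDerivAt
  have hd : ∀ s ≥ t₀, HasDerivAt (fun s => y s * Real.exp (-A s)) 0 s := by
    intro s hs
    have hbs : b s = a s := congrArg a (max_eq_left hs)
    refine ((hy s hs).mul (hA s).neg.exp).congr_deriv ?_
    rw [hbs]
    ring
  have hconst := constant_of_has_deriv_right_zero
    (fun s hs => (hd s hs.1).continuousAt.continuousWithinAt)
    (fun s hs => (hd s hs.1).hasDerivWithinAt) t (Set.right_mem_Icc.2 ht)
  have hpos : 0 < y t * Real.exp (-A t) := by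
    rw [hconst]
    positivity
  exact pos_of_mul_pos_left hpos (Real.exp_pos _).le

/-- Tightness for the normalized softsign gate: the gradient flow f' = T f^T (1-f)^4
satisfies 1 - f(τ) ≥ c·τ^{-1/3} eventually. -/
theorem softsign_gate_rate_tightness
    (T : ℕ) (hT : 0 < T) (τ₀ : ℝ) (f : ℝ → ℝ)
    (hf₀ : 0 < f τ₀ ∧ f τ₀ < 1)
    (hode : ∀ τ ≥ τ₀,
      HasDerivAt f ((T : ℝ) * f τ ^ T * (1 - f τ) ^ 4) τ) :
    ∃ c > (0 : ℝ), ∃ τ₁ ≥ τ₀, ∀ τ ≥ τ₁, c * τ ^ (-(1/3) : ℝ) ≤ 1 - f τ := by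
  have hcont : ContinuousOn f (Set.Ici τ₀) := fun t ht =>
    (hode t ht).continuousAt.continuousWithinAt
  have hpos : ∀ t ≥ τ₀, 0 < f t := fun t ht =>
    pos_of_hasDerivAt_mul_self_s6 (a := fun s => T * f s ^ (T - 1) * (1 - f s) ^ 4) hf₀.1
      (by fun_prop)
      (fun s hs => (hode s hs).congr_deriv (by
        rw [← pow_sub_one_mul hT.ne' (f s)]
        ring)) ht
  have hlt : ∀ t ≥ τ₀, 0 < 1 - f t := fun t ht =>
    pos_of_hasDerivAt_mul_self_s6 (y := fun s => 1 - f s)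
      (a := fun s => -(T * f s ^ T * (1 - f s) ^ 3)) (sub_pos.2 hf₀.2)
      (by fun_prop)
      (fun s hs => ((hode s hs).const_sub 1).congr_deriv (by ring)) ht
  have hderiv : ∀ t ≥ τ₀, HasDerivAt (fun s => ((1 - f s) ^ 3)⁻¹ - 3 * T * s)
      (3 * T * f t ^ T - 3 * T) t := by
    intro t ht
    have hne := (hlt t ht).ne'
    refine (((((hode t ht).const_sub 1).fun_pow 3).fun_inv (pow_ne_zero 3 hne)).sub
      ((hasDerivAt_id t).const_mul (3 * (T : ℝ)))).congr_deriv ?_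
    field_simp
    push_cast
    ring
  have hanti : AntitoneOn (fun s => ((1 - f s) ^ 3)⁻¹ - 3 * T * s) (Set.Ici τ₀) := by
    refine antitoneOn_of_hasDerivWithinAt_nonpos (convex_Ici τ₀)
      (fun t ht => (hderiv t ht).continuousAt.continuousWithinAt)
      (fun t ht => (hderiv t (interior_subset ht)).hasDerivWithinAt) fun t ht => ?_
    have ht' : τ₀ ≤ t := interior_subset ht
    have hle : f t ^ T ≤ 1 := pow_le_one₀ (hpos t ht').le (sub_pos.1 (hlt t ht')).le
    have hT' : (0 : ℝ) ≤ 3 * T := by positivity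
    linarith [mul_le_mul_of_nonneg_left hle hT']
  set g₀ : ℝ := ((1 - f τ₀) ^ 3)⁻¹
  have hg₀ : 0 < g₀ := inv_pos.2 (pow_pos (hlt τ₀ le_rfl) 3)
  set C : ℝ := g₀ + 3 * T * |τ₀| + 3 * T
  have hC : 0 < C := by positivity
  refine ⟨C ^ (-(1/3) : ℝ), by positivity, max τ₀ 1, le_max_left _ _, fun τ hτ => ?_⟩
  have hτ₀ : τ₀ ≤ τ := (le_max_left _ _).trans hτ
  have hτ₁ : 1 ≤ τ := (le_max_right _ _).trans hτ
  have hu := hlt τ hτ₀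
  have hbound : ((1 - f τ) ^ 3)⁻¹ ≤ C * τ := by
    have h := hanti Set.self_mem_Ici hτ₀ hτ₀
    have hK : 0 ≤ g₀ + 3 * T * |τ₀| := by positivity
    have habs : 3 * (T : ℝ) * -τ₀ ≤ 3 * T * |τ₀| := by
      gcongr
      exact neg_le_abs τ₀
    have hmul := mul_le_mul_of_nonneg_left hτ₁ hK
    simp only [C]
    linarith
  calc C ^ (-(1/3) : ℝ) * τ ^ (-(1/3) : ℝ) = (C * τ) ^ (-(1/3) : ℝ) :=
        (Real.mul_rpow hC.le (by linarith)).symm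
    _ ≤ (((1 - f τ) ^ 3)⁻¹) ^ (-(1/3) : ℝ) :=
        Real.rpow_le_rpow_of_nonpos (by positivity) hbound (by norm_num)
    _ = 1 - f τ := by
        rw [Real.rpow_neg (by positivity), Real.inv_rpow (by positivity), inv_inv,
          ← Real.rpow_natCast, ← Real.rpow_mul hu.le]
        norm_num
end

section
/- Let T be a positive integer, τ₀ ∈ ℝ, and let f : ℝ → ℝ be differentiable on [τ₀, ∞) with 1 − exp(−4) < f(τ₀) < 1 and f′(τ) = T · f(τ)^{T+1} · (1 − f(τ))² · (1 + (log(f(τ)/(1 − f(τ))))²) for all τ ≥ τ₀. Then f(τ) < 1 for all τ ≥ τ₀ and there exist a constant C > 0 and τ₁ ≥ τ₀ such that (1 − f(τ)) · (log(1 − f(τ)))² ≤ C/τ for all τ ≥ τ₁. -/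
open Set in
/-- Comparison of two functions on a half-line: `g ≤ h` persists if `g' < h'` at every crossing. -/
lemma le_of_hasDerivAt_lt_of_eq {a : ℝ} {g g' h h' : ℝ → ℝ} (h₀ : g a ≤ h a)
    (hg : ∀ t ≥ a, HasDerivAt g (g' t) t) (hh : ∀ t ≥ a, HasDerivAt h (h' t) t)
    (hlt : ∀ t ≥ a, g t = h t → g' t < h' t) : ∀ t ≥ a, g t ≤ h t := by
  intro t ht
  exact image_le_of_deriv_right_lt_deriv_boundary' (a := a) (b := t)
    (fun x hx => (hg x hx.1).continuousAt.continuousWithinAt)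
    (fun x hx => (hg x hx.1).hasDerivWithinAt) h₀
    (fun x hx => (hh x hx.1).continuousAt.continuousWithinAt)
    (fun x hx => (hh x hx.1).hasDerivWithinAt)
    (fun x hx => hlt x hx.1) (right_mem_Icc.2 ht)

lemma mul_log_sq_le_four {u : ℝ} (hu : 0 < u) (hu1 : u ≤ 1) : u * Real.log u ^ 2 ≤ 4 := by
  have h := Real.abs_log_mul_self_lt (√u) (Real.sqrt_pos.2 hu) (Real.sqrt_le_one.2 hu1)
  have hs := Real.sq_sqrt hu.le
  have hl : Real.log u = 2 * Real.log (√u) := by rw [Real.log_sqrt hu.le]; ring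
  have h2 := (sq_lt_one_iff_abs_lt_one _).2 h
  calc u * Real.log u ^ 2 = 4 * (Real.log (√u) * √u) ^ 2 := by rw [hl, mul_pow _ (√u), hs]; ring
    _ ≤ 4 := by linarith

lemma exp_neg_four_lt_half : Real.exp (-4) < 1 / 2 := by
  have h := Real.add_one_lt_exp (x := 4) (by norm_num)
  rw [Real.exp_neg, inv_lt_comm₀ (Real.exp_pos _) (by norm_num)]
  linarith

/-- The velocity field vanishes at least linearly at the equilibrium `1`. -/
lemma fast_gate_field_lt (T : ℕ) {x : ℝ} (hx : 1 / 2 ≤ x) (hx1 : x < 1) :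
    (T : ℝ) * x ^ (T + 1) * (1 - x) ^ 2 * (1 + Real.log (x / (1 - x)) ^ 2)
      < (5 * T + 1) * (1 - x) := by
  have hu : 0 < 1 - x := by linarith
  have hx0 : 0 < x := by linarith
  have h0 : 0 ≤ Real.log (x / (1 - x)) :=
    Real.log_nonneg ((one_le_div hu).2 (by linarith))
  have h1 : Real.log (x / (1 - x)) ≤ -Real.log (1 - x) := by
    rw [Real.log_div hx0.ne' hu.ne']
    linarith [Real.log_nonpos hx0.le hx1.le]
  have h2 : Real.log (x / (1 - x)) ^ 2 ≤ Real.log (1 - x) ^ 2 := by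
    rw [← neg_sq (Real.log (1 - x))]
    exact pow_le_pow_left₀ h0 h1 2
  have h3 := mul_log_sq_le_four hu (by linarith)
  have h4 : (1 - x) * (1 + Real.log (x / (1 - x)) ^ 2) ≤ 5 := by
    nlinarith [mul_le_mul_of_nonneg_left h2 hu.le]
  have h5 : x ^ (T + 1) ≤ 1 := pow_le_one₀ hx0.le hx1.le
  have hT : (0 : ℝ) ≤ T := T.cast_nonneg
  calc (T : ℝ) * x ^ (T + 1) * (1 - x) ^ 2 * (1 + Real.log (x / (1 - x)) ^ 2)
      = T * x ^ (T + 1) * ((1 - x) * (1 + Real.log (x / (1 - x)) ^ 2)) * (1 - x) := by ring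
    _ ≤ T * 1 * 5 * (1 - x) := by gcongr
    _ < (5 * T + 1) * (1 - x) := by linarith

/-- Derivative of the reciprocal of `(1 - f) (log (1 - f))²`. -/
lemma hasDerivAt_inv_mul_log_sq {f : ℝ → ℝ} {f' t : ℝ} (hf : HasDerivAt f f' t)
    (hu : 0 < 1 - f t) (hl : Real.log (1 - f t) ≠ 0) :
    HasDerivAt (fun s => ((1 - f s) * Real.log (1 - f s) ^ 2)⁻¹)
      (f' * (Real.log (1 - f t) + 2) / ((1 - f t) ^ 2 * Real.log (1 - f t) ^ 3)) t := by
  have h1 : HasDerivAt (fun s => 1 - f s) (-f') t := hf.const_sub 1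
  have h2 := (h1.mul ((h1.log hu.ne').pow 2)).inv
    (mul_ne_zero hu.ne' (pow_ne_zero 2 hl))
  refine h2.congr_deriv ?_
  simp only [Pi.pow_apply, Pi.mul_apply]
  field_simp
  ring

lemma fast_gate_rate_lt {T : ℕ} (hT : 0 < T) {m x : ℝ} (hm : 1 - Real.exp (-4) < m)
    (hmx : m ≤ x) (hx1 : x < 1) :
    (T : ℝ) * m ^ (T + 1) / 8 <
      ((T : ℝ) * x ^ (T + 1) * (1 - x) ^ 2 * (1 + Real.log (x / (1 - x)) ^ 2)) *
        (Real.log (1 - x) + 2) / ((1 - x) ^ 2 * Real.log (1 - x) ^ 3) := by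
  have hu : 0 < 1 - x := by linarith
  have hhalf := exp_neg_four_lt_half
  have hm0 : 0 < m := by linarith
  have hx0 : 0 < x := by linarith
  have hT' : (0 : ℝ) < T := Nat.cast_pos.2 hT
  have hL : Real.log (1 - x) < -4 := (Real.log_lt_iff_lt_exp hu).2 (by linarith)
  have hlx : -1 ≤ Real.log x := by
    have := Real.one_sub_inv_le_log_of_pos hx0
    have h2 : x⁻¹ ≤ 2 := by
      rw [inv_le_comm₀ hx0 (by norm_num)]; linarith
    linarith
  rw [Real.log_div hx0.ne' hu.ne']
  set L := -Real.log (1 - x) with hLdef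
  have hLeq : Real.log (1 - x) = -L := by rw [hLdef, neg_neg]
  rw [hLeq] at hL ⊢
  have hL4 : 4 < L := by linarith
  have key : L ^ 3 / 8 < (1 + (Real.log x - -L) ^ 2) * (L - 2) := by
    have h1 : (L / 2) ^ 2 ≤ (Real.log x - -L) ^ 2 :=
      pow_le_pow_left₀ (by linarith) (by linarith) 2
    nlinarith [mul_le_mul_of_nonneg_right h1 (by linarith : (0 : ℝ) ≤ L - 2),
      mul_pos (by linarith : 0 < L) (by linarith : 0 < L - 4), sq_nonneg L,
      mul_pos (mul_pos (by linarith : 0 < L) (by linarith : 0 < L)) (by linarith : 0 < L - 4)]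
  have hpow : m ^ (T + 1) ≤ x ^ (T + 1) := pow_le_pow_left₀ hm0.le hmx _
  have hL3 : 0 < L ^ 3 := by positivity
  have e : ((T : ℝ) * x ^ (T + 1) * (1 - x) ^ 2 * (1 + (Real.log x - -L) ^ 2)) * (-L + 2) /
      ((1 - x) ^ 2 * (-L) ^ 3) =
      T * x ^ (T + 1) * ((1 + (Real.log x - -L) ^ 2) * (L - 2) / L ^ 3) := by
    have : L ≠ 0 := by positivity
    field_simp
    ring
  rw [e]
  calc (T : ℝ) * m ^ (T + 1) / 8 ≤ T * x ^ (T + 1) * (1 / 8) := by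
        rw [mul_one_div]; gcongr
    _ < _ := by
        refine mul_lt_mul_of_pos_left ?_ (by positivity)
        rw [lt_div_iff₀ hL3]
        linarith

/-- Fast-gate convergence rate: the gradient flow
f' = T f^{T+1} (1-f)² (1 + (log(f/(1-f)))²) satisfies f < 1 and
(1 - f)·(log(1 - f))² ≤ C/τ eventually. -/
theorem fast_gate_convergence_rate
    (T : ℕ) (hT : 0 < T) (τ₀ : ℝ) (f : ℝ → ℝ)
    (hf₀ : 1 - Real.exp (-4) < f τ₀ ∧ f τ₀ < 1)
    (hode : ∀ τ ≥ τ₀,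
      HasDerivAt f ((T : ℝ) * f τ ^ (T + 1) * (1 - f τ) ^ 2 *
        (1 + (Real.log (f τ / (1 - f τ))) ^ 2)) τ) :
    (∀ τ ≥ τ₀, f τ < 1) ∧
    ∃ C > (0 : ℝ), ∃ τ₁ ≥ τ₀, ∀ τ ≥ τ₁,
      (1 - f τ) * (Real.log (1 - f τ)) ^ 2 ≤ C / τ := by
  obtain ⟨hlow, hup⟩ := hf₀
  have hhalf := exp_neg_four_lt_half
  have hm0 : 0 < f τ₀ := by linarith
  have hT' : (0 : ℝ) < T := Nat.cast_pos.2 hT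
  have hmono : ∀ τ ≥ τ₀, f τ₀ ≤ f τ := by
    refine le_of_hasDerivAt_lt_of_eq (g := fun _ => f τ₀) le_rfl
      (fun t _ => hasDerivAt_const t _) hode fun t _ he => ?_
    rw [← he]
    have : 0 < 1 - f τ₀ := by linarith
    positivity
  have hlt : ∀ τ ≥ τ₀, f τ < 1 := by
    set K : ℝ := 5 * T + 1
    have hB : ∀ t ≥ τ₀, HasDerivAt (fun s => 1 - (1 - f τ₀) * Real.exp (-K * (s - τ₀)))
        (K * ((1 - f τ₀) * Real.exp (-K * (t - τ₀)))) t := by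
      intro t _
      have h := (((((hasDerivAt_id t).sub_const τ₀).const_mul (-K)).exp).const_mul
        (1 - f τ₀)).const_sub 1
      refine h.congr_deriv ?_
      simp only [id]
      ring
    have hle := le_of_hasDerivAt_lt_of_eq (by simp) hode hB fun t ht he => by
      have hpos : 0 < (1 - f τ₀) * Real.exp (-K * (t - τ₀)) :=
        mul_pos (by linarith) (Real.exp_pos _)
      have h := fast_gate_field_lt T (x := f t) (by linarith [hmono t ht]) (by linarith)
      have he' : 1 - f t = (1 - f τ₀) * Real.exp (-K * (t - τ₀)) := by linarith
      rw [← he']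
      exact h
    intro τ hτ
    have hpos : 0 < (1 - f τ₀) * Real.exp (-K * (τ - τ₀)) :=
      mul_pos (by linarith) (Real.exp_pos _)
    linarith [hle τ hτ]
  refine ⟨hlt, ?_⟩
  have hlog : ∀ τ ≥ τ₀, Real.log (1 - f τ) ≠ 0 := fun τ hτ =>
    (Real.log_neg (by linarith [hlt τ hτ]) (by linarith [hmono τ hτ])).ne
  set c : ℝ := T * f τ₀ ^ (T + 1) / 8 with hc
  have hc0 : 0 < c := by positivity
  have hgrow : ∀ τ ≥ τ₀, c * (τ - τ₀) ≤ ((1 - f τ) * Real.log (1 - f τ) ^ 2)⁻¹ := by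
    refine le_of_hasDerivAt_lt_of_eq (g := fun τ => c * (τ - τ₀)) (g' := fun _ => c) ?_
      (fun t _ => by simpa using ((hasDerivAt_id t).sub_const τ₀).const_mul c)
      (fun t ht => hasDerivAt_inv_mul_log_sq (hode t ht) (by linarith [hlt t ht]) (hlog t ht))
      (fun t ht _ => fast_gate_rate_lt hT hlow (hmono t ht) (hlt t ht))
    have : 0 < 1 - f τ₀ := by linarith
    rw [sub_self, mul_zero]
    positivity
  refine ⟨2 / c, by positivity, max τ₀ (max (2 * τ₀) 1), le_max_left _ _, fun τ hτ => ?_⟩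
  obtain ⟨h0, h1, h2⟩ : τ₀ ≤ τ ∧ 2 * τ₀ ≤ τ ∧ 1 ≤ τ := by simpa using hτ
  have hτ0 : 0 < τ := by linarith
  have hg : c * τ / 2 ≤ ((1 - f τ) * Real.log (1 - f τ) ^ 2)⁻¹ :=
    le_trans (by nlinarith) (hgrow τ h0)
  have hinv := inv_anti₀ (by positivity) hg
  rw [inv_inv] at hinv
  calc _ ≤ (c * τ / 2)⁻¹ := hinv
    _ = 2 / c / τ := by field_simp
end

section
/- For all real numbers f and r with 0 ≤ f ≤ 1 and 1/2 ≤ r ≤ 1, setting g = 2·r·f + (1 − 2·r)·f², the following inequalities hold: f·(1 − g) ≤ 2·f·(1 − f)·(r + (1 − 2·r)·f) ≤ 2·f·(1 − g). -/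
/-- Refine-gate bound on ∂g/∂z: for 0 ≤ f ≤ 1 and 1/2 ≤ r ≤ 1, with
g = 2rf + (1-2r)f², we have f(1-g) ≤ 2f(1-f)(r + (1-2r)f) ≤ 2f(1-g). -/
theorem refine_gate_dgdz_bounds
    (f r : ℝ) (hf0 : 0 ≤ f) (hf1 : f ≤ 1) (hr0 : 1 / 2 ≤ r) (hr1 : r ≤ 1) :
    f * (1 - (2 * r * f + (1 - 2 * r) * f ^ 2)) ≤
      2 * f * (1 - f) * (r + (1 - 2 * r) * f) ∧
    2 * f * (1 - f) * (r + (1 - 2 * r) * f) ≤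
      2 * f * (1 - (2 * r * f + (1 - 2 * r) * f ^ 2)) := by
  have hf : 0 ≤ f * (1 - f) := mul_nonneg hf0 (sub_nonneg.2 hf1)
  constructor
  · have h : 0 ≤ f * (1 - f) * ((2 * r - 1) * (1 - f)) :=
      mul_nonneg hf (mul_nonneg (by linarith) (sub_nonneg.2 hf1))
    linarith
  · have h : 0 ≤ f * (1 - f) * (1 - r) := mul_nonneg hf (sub_nonneg.2 hr1)
    linarith
end

section
/- Let C and C̃ be constants with 0 < C ≤ C̃, let τ₀ ∈ ℝ, and let g : ℝ → ℝ be differentiable on [τ₀, ∞) with 0 < g(τ₀) < 1 and C·(1 − g(τ))² ≤ g′(τ) ≤ C̃·(1 − g(τ))² for all τ ≥ τ₀. Then g(τ) < 1 for all τ ≥ τ₀, and there exist constants c₁, c₂ > 0 and τ₁ ≥ τ₀ such that c₁/τ ≤ 1 − g(τ) ≤ c₂/τ for all τ ≥ τ₁. -/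
/-- A function whose derivative is strictly smaller than that of another wherever the two agree
stays below it if it starts below it. -/
lemma le_of_hasDerivAt_lt_of_eq_s10 {f f' B B' : ℝ → ℝ} {a : ℝ}
    (hf : ∀ x ≥ a, HasDerivAt f (f' x) x) (hB : ∀ x ≥ a, HasDerivAt B (B' x) x)
    (ha : f a ≤ B a) (h : ∀ x ≥ a, f x = B x → f' x < B' x) :
    ∀ x ≥ a, f x ≤ B x := fun x hx =>
  image_le_of_deriv_right_lt_deriv_boundary' (b := x)
    (fun y hy => (hf y hy.1).continuousAt.continuousWithinAt)
    (fun y hy => (hf y hy.1).hasDerivWithinAt) ha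
    (fun y hy => (hB y hy.1).continuousAt.continuousWithinAt)
    (fun y hy => (hB y hy.1).hasDerivWithinAt)
    (fun y hy => h y hy.1) ⟨hx, le_rfl⟩

/-- The explicit solution of the flow `y' = A * (1 - y) ^ 2`. -/
lemma hasDerivAt_one_sub_inv_affine {K A a x : ℝ} (h : K + A * (x - a) ≠ 0) :
    HasDerivAt (fun t => 1 - (K + A * (t - a))⁻¹)
      (A * (1 - (1 - (K + A * (x - a))⁻¹)) ^ 2) x := by
  have h₁ : HasDerivAt (fun t => K + A * (t - a)) A x := by
    simpa using (((hasDerivAt_id x).sub_const a).const_mul A).const_add K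
  refine ((h₁.fun_inv h).const_sub 1).congr_deriv ?_
  rw [sub_sub_cancel, inv_pow]
  ring

/-- Comparison lemma: if C(1-g)² ≤ g' ≤ C̃(1-g)² with 0 < C ≤ C̃ and 0 < g(τ₀) < 1,
then g < 1 throughout and 1 - g(τ) = Θ(τ⁻¹). -/
theorem sandwiched_flow_rate
    (C Ct : ℝ) (hC : 0 < C) (hCCt : C ≤ Ct) (τ₀ : ℝ) (g : ℝ → ℝ)
    (hg₀ : 0 < g τ₀ ∧ g τ₀ < 1)
    (hode : ∀ τ ≥ τ₀, ∃ d : ℝ, HasDerivAt g d τ ∧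
      C * (1 - g τ) ^ 2 ≤ d ∧ d ≤ Ct * (1 - g τ) ^ 2) :
    (∀ τ ≥ τ₀, g τ < 1) ∧
    ∃ c₁ > (0 : ℝ), ∃ c₂ > (0 : ℝ), ∃ τ₁ ≥ τ₀, ∀ τ ≥ τ₁,
      c₁ / τ ≤ 1 - g τ ∧ 1 - g τ ≤ c₂ / τ := by
  obtain ⟨-, hg₁⟩ := hg₀
  choose! d hd hdl hdu using hode
  set K := (1 - g τ₀)⁻¹ with hK
  have hKpos : 0 < K := inv_pos.2 (by linarith)
  have hCt : 0 < Ct := hC.trans_le hCCt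
  have hpos : ∀ A > (0 : ℝ), ∀ τ ≥ τ₀, 0 < K + A * (τ - τ₀) := fun A hA τ hτ =>
    add_pos_of_pos_of_nonneg hKpos (mul_nonneg hA.le (sub_nonneg.2 hτ))
  have hupper : ∀ τ ≥ τ₀, g τ ≤ 1 - (K + (Ct + 1) * (τ - τ₀))⁻¹ := by
    refine le_of_hasDerivAt_lt_of_eq_s10 hd
      (fun τ hτ => hasDerivAt_one_sub_inv_affine (hpos _ (by linarith) τ hτ).ne')
      (by simp [hK]) fun τ hτ heq => ?_
    have hp := inv_pos.2 (hpos (Ct + 1) (by linarith) τ hτ)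
    have := hdu τ hτ
    rw [← heq]
    have : 0 < (1 - g τ) ^ 2 := pow_pos (by linarith) 2
    linarith
  have hlower : ∀ τ ≥ τ₀, 1 - (K + C / 2 * (τ - τ₀))⁻¹ ≤ g τ := by
    refine le_of_hasDerivAt_lt_of_eq_s10
      (fun τ hτ => hasDerivAt_one_sub_inv_affine (hpos _ (by linarith) τ hτ).ne') hd
      (by simp [hK]) fun τ hτ heq => ?_
    have hp := inv_pos.2 (hpos (C / 2) (by linarith) τ hτ)
    have := hdl τ hτ
    rw [heq]
    have : 0 < C * (1 - g τ) ^ 2 := mul_pos hC (pow_pos (by linarith) 2)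
    linarith
  refine ⟨fun τ hτ => ?_, (K + (Ct + 1) * (1 + |τ₀|))⁻¹, by positivity, 4 / C, by positivity,
    1 + 2 * |τ₀|, by linarith [le_abs_self τ₀, abs_nonneg τ₀], fun τ hτ => ?_⟩
  · have := inv_pos.2 (hpos (Ct + 1) (by linarith) τ hτ)
    linarith [hupper τ hτ]
  have habs := abs_nonneg τ₀
  have hle := le_abs_self τ₀
  have hneg := neg_abs_le τ₀
  have hτ₀ : τ₀ ≤ τ := by linarith
  have hτ₁ : 1 ≤ τ := by linarith
  have hτpos : 0 < τ := by linarith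
  constructor
  · calc (K + (Ct + 1) * (1 + |τ₀|))⁻¹ / τ = ((K + (Ct + 1) * (1 + |τ₀|)) * τ)⁻¹ := by
          rw [mul_inv, div_eq_mul_inv]
      _ ≤ (K + (Ct + 1) * (τ - τ₀))⁻¹ := by
          refine inv_anti₀ (hpos _ (by linarith) τ hτ₀) ?_
          have h₁ : K ≤ K * τ := le_mul_of_one_le_right hKpos.le hτ₁
          have h₂ : τ - τ₀ ≤ (1 + |τ₀|) * τ := by nlinarith
          have h₃ := mul_le_mul_of_nonneg_left h₂ (by linarith : 0 ≤ Ct + 1)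
          linarith
      _ ≤ 1 - g τ := by linarith [hupper τ hτ₀]
  · calc 1 - g τ ≤ (K + C / 2 * (τ - τ₀))⁻¹ := by linarith [hlower τ hτ₀]
      _ ≤ (C / 4 * τ)⁻¹ := by
          refine inv_anti₀ (by positivity) ?_
          nlinarith
      _ = 4 / C / τ := by field_simp
end

section
/- Let T be a positive integer, τ₀ ∈ ℝ, and let z, w : ℝ → ℝ be differentiable on [τ₀, ∞). Define f = σ ∘ z, r = σ ∘ w, and g = 2·r·f + (1 − 2·r)·f², where σ(x) = 1/(1 + exp(−x)). Suppose that for all τ ≥ τ₀ the gradient-flow equations z′(τ) = T·g(τ)^{T−1} · 2·f(τ)·(1 − f(τ))·(r(τ) + (1 − 2·r(τ))·f(τ)) and w′(τ) = T·g(τ)^{T−1} · 2·f(τ)·r(τ)·(1 − r(τ))·(1 − f(τ)) hold, and that r(τ₀) ≥ 1/2. Then there exist constants c₁, c₂ > 0 and τ₁ ≥ τ₀ such that c₁/τ ≤ 1 − g(τ) ≤ c₂/τ for all τ ≥ τ₁. -/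
/-- A function whose derivative is at least `c` on `[a, ∞)` grows at least linearly there. -/
theorem add_mul_sub_le_of_le_hasDerivAt {φ φ' : ℝ → ℝ} {a c : ℝ}
    (hφ : ∀ x ≥ a, HasDerivAt φ (φ' x) x) (hc : ∀ x ≥ a, c ≤ φ' x) {x : ℝ} (hx : a ≤ x) :
    φ a + c * (x - a) ≤ φ x := by
  have key := (convex_Ici a).mul_sub_le_image_sub_of_le_deriv (f := φ) (C := c)
    (fun y hy => (hφ y hy).continuousAt.continuousWithinAt)
    (fun y hy => (hφ y (interior_subset hy)).differentiableAt.differentiableWithinAt)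
    (fun y hy => by
      rw [(hφ y (interior_subset hy)).deriv]
      exact hc y (interior_subset hy))
    a Set.self_mem_Ici x hx hx
  linarith

/-- A function whose derivative is at most `c` on `[a, ∞)` grows at most linearly there. -/
theorem le_add_mul_sub_of_hasDerivAt_le {φ φ' : ℝ → ℝ} {a c : ℝ}
    (hφ : ∀ x ≥ a, HasDerivAt φ (φ' x) x) (hc : ∀ x ≥ a, φ' x ≤ c) {x : ℝ} (hx : a ≤ x) :
    φ x ≤ φ a + c * (x - a) := by
  have key := add_mul_sub_le_of_le_hasDerivAt (fun y hy => (hφ y hy).fun_neg)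
    (fun y hy => neg_le_neg (hc y hy)) hx
  linarith

/-- A quantity `u > 0` whose decay rate lies between constant multiples of `u ^ 2`
is of order `x⁻¹`. -/
theorem exists_div_le_and_le_div_of_quadratic_decay {u v : ℝ → ℝ} {a c C : ℝ}
    (hc : 0 < c) (hC : 0 < C) (hu : ∀ x ≥ a, 0 < u x)
    (hd : ∀ x ≥ a, HasDerivAt u (-v x) x)
    (hl : ∀ x ≥ a, c * u x ^ 2 ≤ v x) (hr : ∀ x ≥ a, v x ≤ C * u x ^ 2) :
    ∃ c₁ > (0 : ℝ), ∃ c₂ > (0 : ℝ), ∃ b ≥ a, ∀ x ≥ b, c₁ / x ≤ u x ∧ u x ≤ c₂ / x := by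
  have hd' : ∀ x ≥ a, HasDerivAt (fun y => (u y)⁻¹) (v x / u x ^ 2) x := fun x hx => by
    simpa using (hd x hx).fun_inv (hu x hx).ne'
  have hua : 0 < (u a)⁻¹ := inv_pos.2 (hu a le_rfl)
  refine ⟨1 / ((u a)⁻¹ + 2 * C), by positivity, 2 / c, by positivity, 2 * |a| + 1,
    by linarith [le_abs_self a, abs_nonneg a], fun x hx => ?_⟩
  have ha := abs_nonneg a
  have hxa : a ≤ x := by linarith [le_abs_self a]
  have hx1 : 1 ≤ x := by linarith
  have hux := hu x hxa
  have lower := add_mul_sub_le_of_le_hasDerivAt hd'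
    (fun y hy => (le_div_iff₀ (pow_pos (hu y hy) 2)).2 (hl y hy)) hxa
  have upper := le_add_mul_sub_of_hasDerivAt_le hd'
    (fun y hy => (div_le_iff₀ (pow_pos (hu y hy) 2)).2 (hr y hy)) hxa
  constructor
  · have h : (u x)⁻¹ ≤ ((u a)⁻¹ + 2 * C) * x := by
      nlinarith [mul_le_mul_of_nonneg_left (show x - a ≤ 2 * x by linarith [neg_abs_le a]) hC.le]
    rw [div_div, one_div]
    exact inv_le_of_inv_le₀ hux h
  · have h : c / 2 * x ≤ (u x)⁻¹ := by
      nlinarith [mul_le_mul_of_nonneg_left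
        (show x / 2 ≤ x - a by linarith [le_abs_self a]) hc.le]
    calc u x ≤ (c / 2 * x)⁻¹ := le_inv_of_le_inv₀ (by positivity) h
      _ = 2 / c / x := by field_simp

/-- The effective gate value of a refine gate with forget gate `f` and auxiliary gate `r`. -/
def refineGate (r f : ℝ) : ℝ := 2 * r * f + (1 - 2 * r) * f ^ 2

/-- The squared norm of the gradient of the effective gate value `refineGate (σ w) (σ z)` in
`(z, w)`, written in terms of `f = σ z` and `r = σ w`. -/
def refineGateGradSq (r f : ℝ) : ℝ :=
  (2 * f * (1 - f) * (r + (1 - 2 * r) * f)) ^ 2 + (2 * f * r * (1 - r) * (1 - f)) ^ 2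

theorem one_sub_refineGate (r f : ℝ) :
    1 - refineGate r f = (1 - f) * ((1 - r) + (r + (1 - 2 * r) * f)) := by
  unfold refineGate; ring

theorem refineGate_lt_one {r f : ℝ} (hr0 : 0 < r) (hr1 : r < 1) (hf0 : 0 < f) (hf1 : f < 1) :
    refineGate r f < 1 := by
  rw [← sub_pos, one_sub_refineGate]
  have h : 0 < r * (1 - f) + (1 - r) * f := by
    have := sub_pos.2 hr1; have := sub_pos.2 hf1; positivity
  exact mul_pos (by linarith) (by linarith)

theorem sq_le_refineGate {r f : ℝ} (hr : 1 / 2 ≤ r) (hf0 : 0 ≤ f) (hf1 : f ≤ 1) :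
    f ^ 2 ≤ refineGate r f := by
  unfold refineGate
  nlinarith [mul_nonneg (mul_nonneg (show 0 ≤ r by linarith) hf0) (sub_nonneg.2 hf1)]

theorem one_sub_le_add_mul {r f : ℝ} (hr : 1 / 2 ≤ r) (hf1 : f ≤ 1) :
    1 - r ≤ r + (1 - 2 * r) * f := by
  nlinarith [mul_nonneg (show 0 ≤ 2 * r - 1 by linarith) (sub_nonneg.2 hf1)]

theorem mul_one_sub_refineGate_sq_le_refineGateGradSq {r f : ℝ} (hr : 1 / 2 ≤ r) (hr1 : r ≤ 1)
    (hf1 : f ≤ 1) :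
    f ^ 2 * (1 - refineGate r f) ^ 2 ≤ refineGateGradSq r f := by
  rw [one_sub_refineGate, refineGateGradSq]
  have hA := one_sub_le_add_mul hr hf1
  set A := r + (1 - 2 * r) * f
  have hB : (1 - r + A) ^ 2 ≤ 4 * A ^ 2 := by nlinarith
  have := mul_le_mul_of_nonneg_left hB (sq_nonneg (f * (1 - f)))
  nlinarith [sq_nonneg (2 * f * r * (1 - r) * (1 - f))]

theorem refineGateGradSq_le {r f : ℝ} (hr : 1 / 2 ≤ r) (hr1 : r ≤ 1) (hf0 : 0 ≤ f)
    (hf1 : f ≤ 1) :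
    refineGateGradSq r f ≤ 8 * (1 - refineGate r f) ^ 2 := by
  rw [one_sub_refineGate, refineGateGradSq]
  have hA := one_sub_le_add_mul hr hf1
  set A := r + (1 - 2 * r) * f
  have hs : 0 ≤ 1 - r := sub_nonneg.2 hr1
  have hAB : A ^ 2 ≤ (1 - r + A) ^ 2 := by gcongr; linarith; linarith
  have hrB : (r * (1 - r)) ^ 2 ≤ (1 - r + A) ^ 2 := by
    have : 0 ≤ r := by linarith
    gcongr
    nlinarith
  have hf2 : f ^ 2 ≤ 1 := pow_le_one₀ hf0 hf1
  calc (2 * f * (1 - f) * A) ^ 2 + (2 * f * r * (1 - r) * (1 - f)) ^ 2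
      = f ^ 2 * (4 * (1 - f) ^ 2 * (A ^ 2 + (r * (1 - r)) ^ 2)) := by ring
    _ ≤ 1 * (4 * (1 - f) ^ 2 * ((1 - r + A) ^ 2 + (1 - r + A) ^ 2)) := by gcongr
    _ = 8 * ((1 - f) * (1 - r + A)) ^ 2 := by ring

theorem HasDerivAt.refineGate {r f : ℝ → ℝ} {r' f' x : ℝ} (hr : HasDerivAt r r' x)
    (hf : HasDerivAt f f' x) :
    HasDerivAt (fun y => refineGate (r y) (f y))
      (2 * (r x + (1 - 2 * r x) * f x) * f' + 2 * f x * (1 - f x) * r') x := by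
  refine (((hr.const_mul 2).fun_mul hf).fun_add
    (((hr.const_mul 2).const_sub 1).fun_mul (hf.fun_pow 2))).congr_deriv ?_
  push_cast
  ring


/-- Refine-gate gradient flow: with f = σ∘z, r = σ∘w, g = 2rf + (1-2r)f², the gradient
flow of the toy loss L = 1 - g^T (with r(τ₀) ≥ 1/2) yields 1 - g(τ) = Θ(τ⁻¹). -/
theorem refine_gate_convergence_rate
    (T : ℕ) (hT : 0 < T) (τ₀ : ℝ) (z w : ℝ → ℝ)
    (σ f r g : ℝ → ℝ)
    (hσ : ∀ x, σ x = 1 / (1 + Real.exp (-x)))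
    (hf : ∀ τ, f τ = σ (z τ)) (hr : ∀ τ, r τ = σ (w τ))
    (hg : ∀ τ, g τ = 2 * r τ * f τ + (1 - 2 * r τ) * f τ ^ 2)
    (hz : ∀ τ ≥ τ₀, HasDerivAt z
      ((T : ℝ) * g τ ^ (T - 1) *
        (2 * f τ * (1 - f τ) * (r τ + (1 - 2 * r τ) * f τ))) τ)
    (hw : ∀ τ ≥ τ₀, HasDerivAt w
      ((T : ℝ) * g τ ^ (T - 1) *
        (2 * f τ * r τ * (1 - r τ) * (1 - f τ))) τ)
    (hr₀ : 1 / 2 ≤ r τ₀) :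
    ∃ c₁ > (0 : ℝ), ∃ c₂ > (0 : ℝ), ∃ τ₁ ≥ τ₀, ∀ τ ≥ τ₁,
      c₁ / τ ≤ 1 - g τ ∧ 1 - g τ ≤ c₂ / τ := by
  obtain rfl : σ = Real.sigmoid := funext fun x => by rw [hσ, Real.sigmoid_def, one_div]
  obtain rfl : g = fun τ => refineGate (r τ) (f τ) := funext hg
  have hf0 τ : 0 < f τ := hf τ ▸ Real.sigmoid_pos _
  have hf1 τ : f τ < 1 := hf τ ▸ Real.sigmoid_lt_one _
  have hr0 τ : 0 < r τ := hr τ ▸ Real.sigmoid_pos _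
  have hr1 τ : r τ < 1 := hr τ ▸ Real.sigmoid_lt_one _
  have hf' τ (hτ : τ₀ ≤ τ) := (Real.hasDerivAt_sigmoid (z τ)).comp τ (hz τ hτ)
  have hr' τ (hτ : τ₀ ≤ τ) := (Real.hasDerivAt_sigmoid (w τ)).comp τ (hw τ hτ)
  rw [show Real.sigmoid ∘ z = f from (funext hf).symm] at hf'
  rw [show Real.sigmoid ∘ w = r from (funext hr).symm] at hr'
  simp only [← hf] at hf'
  simp only [← hr] at hr'
  have hA0 τ : 0 ≤ r τ + (1 - 2 * r τ) * f τ := by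
    nlinarith [mul_pos (hr0 τ) (sub_pos.2 (hf1 τ)), mul_pos (sub_pos.2 (hr1 τ)) (hf0 τ)]
  have hg0 τ : 0 ≤ refineGate (r τ) (f τ) := by
    rw [show refineGate (r τ) (f τ) = f τ * (r τ + (r τ + (1 - 2 * r τ) * f τ)) by
      unfold refineGate; ring]
    exact mul_nonneg (hf0 τ).le (add_nonneg (hr0 τ).le (hA0 τ))
  have hf1' τ := (sub_pos.2 (hf1 τ)).le
  have hr1' τ := (sub_pos.2 (hr1 τ)).le
  have hf_ge τ (hτ : τ₀ ≤ τ) : f τ₀ ≤ f τ := by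
    simpa using add_mul_sub_le_of_le_hasDerivAt (c := 0) hf' (fun y _ => by
      have := hg0 y; have := hA0 y; have := hf0 y; have := hf1' y; positivity) hτ
  have hr_ge τ (hτ : τ₀ ≤ τ) : 1 / 2 ≤ r τ := by
    refine hr₀.trans ?_
    simpa using add_mul_sub_le_of_le_hasDerivAt (c := 0) hr' (fun y _ => by
      have := hg0 y; have := hf0 y; have := hf1' y; have := hr0 y; have := hr1' y
      positivity) hτ
  have hT' : (0 : ℝ) < T := Nat.cast_pos.2 hT
  have hf₀ := hf0 τ₀
  refine exists_div_le_and_le_div_of_quadratic_decay (a := τ₀)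
    (v := fun τ => T * refineGate (r τ) (f τ) ^ (T - 1) * refineGateGradSq (r τ) (f τ))
    (c := T * (f τ₀ ^ 2) ^ (T - 1) * f τ₀ ^ 2) (C := 8 * T) (by positivity) (by positivity)
    (fun τ _ => sub_pos.2 (refineGate_lt_one (hr0 τ) (hr1 τ) (hf0 τ) (hf1 τ)))
    (fun τ hτ => ?_) (fun τ hτ => ?_) (fun τ hτ => ?_)
  · refine (((hr' τ hτ).refineGate (hf' τ hτ)).const_sub 1).congr_deriv ?_
    unfold refineGateGradSq
    ring
  · have hfτ := hf_ge τ hτ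
    have hfg : f τ₀ ^ 2 ≤ refineGate (r τ) (f τ) :=
      (pow_le_pow_left₀ hf₀.le hfτ 2).trans
        (sq_le_refineGate (hr_ge τ hτ) (hf0 τ).le (hf1 τ).le)
    have hgτ := hg0 τ
    calc T * (f τ₀ ^ 2) ^ (T - 1) * f τ₀ ^ 2 * (1 - refineGate (r τ) (f τ)) ^ 2
        = T * (f τ₀ ^ 2) ^ (T - 1) * (f τ₀ ^ 2 * (1 - refineGate (r τ) (f τ)) ^ 2) := by ring
      _ ≤ T * refineGate (r τ) (f τ) ^ (T - 1) *
          (f τ ^ 2 * (1 - refineGate (r τ) (f τ)) ^ 2) := by gcongr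
      _ ≤ _ := by
        gcongr
        exact mul_one_sub_refineGate_sq_le_refineGateGradSq (hr_ge τ hτ) (hr1 τ).le (hf1 τ).le
  · have hgτ := hg0 τ
    have hpow : refineGate (r τ) (f τ) ^ (T - 1) ≤ 1 :=
      pow_le_one₀ hgτ (refineGate_lt_one (hr0 τ) (hr1 τ) (hf0 τ) (hf1 τ)).le
    calc T * refineGate (r τ) (f τ) ^ (T - 1) * refineGateGradSq (r τ) (f τ)
        ≤ T * 1 * (8 * (1 - refineGate (r τ) (f τ)) ^ 2) := by
          gcongr
          · unfold refineGateGradSq; positivity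
          · exact refineGateGradSq_le (hr_ge τ hτ) (hr1 τ).le (hf0 τ).le (hf1 τ).le
      _ = 8 * T * (1 - refineGate (r τ) (f τ)) ^ 2 := by ring
end

section
/- Let φ(z) = σ(sinh z), where σ(x) = 1/(1 + exp(−x)) is the logistic sigmoid. Then for every a > 1, exp(−exp(a·z))/(1 − φ(z)) → 0 as z → ∞. -/
open Filter

theorem div_one_sub_logistic (y x : ℝ) :
    y / (1 - 1 / (1 + Real.exp (-x))) = y * (1 + Real.exp x) := by
  have h : 1 - 1 / (1 + Real.exp (-x)) = (1 + Real.exp x)⁻¹ := by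
    rw [one_div, ← Real.sigmoid_def, ← Real.sigmoid_neg, Real.sigmoid_def, neg_neg]
  rw [h, div_inv_eq_mul]

/-- The fast gate φ(z) = σ(sinh z) has doubly exponential order of saturation: for every
a > 1, e^{-e^{az}}/(1 - φ(z)) → 0 as z → ∞. -/
theorem fast_gate_order_of_saturation
    (σ φ : ℝ → ℝ)
    (hσ : ∀ x, σ x = 1 / (1 + Real.exp (-x)))
    (hφ : ∀ z, φ z = σ (Real.sinh z)) :
    ∀ a > (1 : ℝ),
      Tendsto (fun z => Real.exp (-Real.exp (a * z)) / (1 - φ z)) atTop (nhds 0) := by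
  intro a ha
  simp only [hφ, hσ, div_one_sub_logistic]
  have hlim : Tendsto (fun z : ℝ => 2 * Real.exp (-(Real.exp z / 2))) atTop (nhds 0) := by
    simpa using (Real.tendsto_exp_neg_atTop_nhds_zero.comp
      (Real.tendsto_exp_atTop.atTop_div_const two_pos)).const_mul 2
  refine squeeze_zero' (.of_forall fun z => by positivity) ?_ hlim
  filter_upwards [eventually_ge_atTop 0] with z hz
  have hE : Real.exp z ≤ Real.exp (a * z) := Real.exp_le_exp.2 (by nlinarith)
  have hs : Real.sinh z ≤ Real.exp z / 2 := by
    rw [Real.sinh_eq]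
    linarith [Real.exp_pos (-z)]
  have h₁ : Real.exp (-Real.exp (a * z)) ≤ Real.exp (-(Real.exp z / 2)) :=
    Real.exp_le_exp.2 (by linarith [Real.exp_pos z])
  have h₂ : Real.exp (-Real.exp (a * z) + Real.sinh z) ≤ Real.exp (-(Real.exp z / 2)) :=
    Real.exp_le_exp.2 (by linarith)
  rw [mul_add, mul_one, ← Real.exp_add]
  linarith
end

section
/- Let σ(x) = 1/(1 + exp(−x)) and let φ(z) = σ(sinh z) be the fast gate. Then for every a > 0, (1 − φ(z))/(1 − σ(a·z)) → 0 as z → ∞, and the function sinh = σ⁻¹ ∘ φ is convex on [0, ∞). Hence the fast gate has a higher order of saturation than the sigmoid function. -/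
open Filter

theorem convexOn_sinh_Ici : ConvexOn ℝ (Set.Ici 0) Real.sinh := by
  refine MonotoneOn.convexOn_of_deriv (convex_Ici 0) Real.continuous_sinh.continuousOn
    Real.differentiable_sinh.differentiableOn ?_
  rw [Real.deriv_sinh, interior_Ici]
  intro x hx y hy hxy
  rw [Set.mem_Ioi] at hx hy
  rwa [Real.cosh_le_cosh, abs_of_pos hx, abs_of_pos hy]

/-- The hyperbolic sine eventually dominates every linear function. -/
theorem eventually_mul_le_sinh (c : ℝ) : ∀ᶠ z in atTop, c * z ≤ Real.sinh z := by
  have h := Real.tendsto_mul_exp_add_div_pow_atTop (1 / 2) (-1 / 2) 1 (by norm_num)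
  filter_upwards [h.eventually_ge_atTop c, eventually_gt_atTop 0] with z hz hpos
  rw [pow_one, le_div_iff₀ hpos] at hz
  have hexp : Real.exp (-z) ≤ 1 := Real.exp_le_one_iff.mpr (by linarith)
  rw [Real.sinh_eq]
  linarith

theorem one_sub_logistic (x : ℝ) :
    1 - 1 / (1 + Real.exp (-x)) = 1 / (1 + Real.exp x) := by
  have h := Real.exp_pos x
  rw [Real.exp_neg]
  field_simp
  ring

/-- The fast gate φ(z) = σ(sinh z) has a higher order of saturation than the sigmoid:
for every a > 0, (1 - φ(z))/(1 - σ(az)) → 0 as z → ∞, and sinh = σ⁻¹ ∘ φ is convex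
on [0, ∞). -/
theorem fast_gate_higher_order_than_sigmoid
    (σ φ : ℝ → ℝ)
    (hσ : ∀ x, σ x = 1 / (1 + Real.exp (-x)))
    (hφ : ∀ z, φ z = σ (Real.sinh z)) :
    (∀ a > (0 : ℝ),
      Tendsto (fun z => (1 - φ z) / (1 - σ (a * z))) atTop (nhds 0)) ∧
    ConvexOn ℝ (Set.Ici 0) Real.sinh := by
  refine ⟨fun a ha => ?_, convexOn_sinh_Ici⟩
  simp only [hφ, hσ, one_sub_logistic]
  have hlim : Tendsto (fun z : ℝ => 2 * Real.exp (-z)) atTop (nhds 0) := by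
    simpa using Real.tendsto_exp_neg_atTop_nhds_zero.const_mul 2
  refine squeeze_zero' (Eventually.of_forall fun z => by positivity) ?_ hlim
  filter_upwards [eventually_mul_le_sinh (a + 1), eventually_ge_atTop 0] with z hz hpos
  have hone : 1 ≤ Real.exp (a * z) := Real.one_le_exp (by positivity)
  have hprod : Real.exp (a * z) ≤ Real.exp (-z) * Real.exp (Real.sinh z) := by
    rw [← Real.exp_add]
    exact Real.exp_le_exp.mpr (by linarith)
  rw [div_div_eq_mul_div, div_one, one_div_mul_eq_div, div_le_iff₀ (by positivity)]
  linarith [Real.exp_pos (-z)]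
end

section
/- Let σ(z) = 1/(1 + exp(−z)) and let σ_ns(z) = (z/(2 + |z|) + 1)/2 be the normalized softsign function. Then for every a > 0, (1 − σ(z))/(1 − σ_ns(a·z)) → 0 as z → ∞, and the composite σ_ns⁻¹ ∘ σ satisfies σ_ns⁻¹(σ(z)) = exp(z) − 1 for all z ∈ ℝ with σ(z) > 1/2 — equivalently z > 0 — and z ↦ exp(z) − 1 is convex. Hence the sigmoid has a higher order of saturation than the normalized softsign function. -/
open Filter

/-- On the nonnegative half-line the normalized softsign is `z ↦ 1 - 1 / (z + 2)`. -/
theorem normalized_softsign_of_nonneg {z : ℝ} (hz : 0 ≤ z) :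
    (z / (2 + |z|) + 1) / 2 = 1 - 1 / (z + 2) := by
  rw [abs_of_nonneg hz]
  field_simp
  ring

theorem normalized_softsign_of_neg_lt_half {z : ℝ} (hz : z < 0) :
    (z / (2 + |z|) + 1) / 2 < 1 / 2 := by
  have : z / (2 + |z|) < 0 := div_neg_of_neg_of_pos hz (by positivity)
  linarith

theorem one_div_one_add_exp_neg (z : ℝ) :
    1 / (1 + Real.exp (-z)) = 1 - 1 / (Real.exp z + 1) := by
  rw [Real.exp_neg]
  field_simp
  ring

theorem tendsto_linear_mul_exp_neg_atTop (a b : ℝ) :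
    Tendsto (fun z : ℝ => (a * z + b) * Real.exp (-z)) atTop (nhds 0) := by
  have h₁ := (Real.tendsto_pow_mul_exp_neg_atTop_nhds_zero 1).const_mul a
  have h₀ := (Real.tendsto_pow_mul_exp_neg_atTop_nhds_zero 0).const_mul b
  have h := h₁.add h₀
  simp only [mul_zero, add_zero] at h
  refine h.congr fun z => ?_
  ring

/-- The sigmoid has a higher order of saturation than the normalized softsign:
for every a > 0, (1 - σ(z))/(1 - σ_ns(az)) → 0 as z → ∞, the composite σ_ns⁻¹ ∘ σ
is z ↦ exp z - 1 for z > 0, and exp z - 1 is convex. -/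
theorem sigmoid_higher_order_than_softsign
    (σ σns : ℝ → ℝ)
    (hσ : ∀ z, σ z = 1 / (1 + Real.exp (-z)))
    (hσns : ∀ z, σns z = (z / (2 + |z|) + 1) / 2) :
    (∀ a > (0 : ℝ),
      Tendsto (fun z => (1 - σ z) / (1 - σns (a * z))) atTop (nhds 0)) ∧
    (∀ z : ℝ, 0 < z → σns (Real.exp z - 1) = σ z ∧
      (∀ y : ℝ, σns y = σ z → y = Real.exp z - 1)) ∧
    ConvexOn ℝ Set.univ (fun z : ℝ => Real.exp z - 1) := by
  refine ⟨fun a ha => ?_, fun z hz => ?_, ?_⟩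
  · refine squeeze_zero' ?_ ?_ (tendsto_linear_mul_exp_neg_atTop a 2)
    all_goals
      filter_upwards [eventually_ge_atTop 0] with z hz
      have haz : 0 ≤ a * z := mul_nonneg ha.le hz
      have hratio : (1 - σ z) / (1 - σns (a * z)) = (a * z + 2) / (Real.exp z + 1) := by
        rw [hσ, hσns, normalized_softsign_of_nonneg haz, one_div_one_add_exp_neg,
          sub_sub_cancel, sub_sub_cancel, div_div_div_eq, one_mul, mul_one]
      rw [hratio]
    · positivity
    · rw [Real.exp_neg, ← div_eq_mul_inv]
      gcongr
      linarith
  · have hexp : 1 < Real.exp z := Real.one_lt_exp_iff.2 hz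
    rw [hσ, one_div_one_add_exp_neg]
    refine ⟨?_, fun y hy => ?_⟩
    · rw [hσns, normalized_softsign_of_nonneg (by linarith)]
      ring
    · rw [hσns] at hy
      rcases lt_or_ge y 0 with hneg | hnonneg
      · have hlt := normalized_softsign_of_neg_lt_half hneg
        have : 1 / (Real.exp z + 1) < 1 / 2 := by
          gcongr
          linarith
        linarith
      · rw [normalized_softsign_of_nonneg hnonneg] at hy
        have hinv : (y + 2)⁻¹ = (Real.exp z + 1)⁻¹ := by
          simpa using hy
        linarith [inv_injective hinv]
  · exact convexOn_exp.sub (concaveOn_const 1 convex_univ)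
end

section
/- Let φ(z) = σ(sinh z) be the fast gate, where σ(x) = 1/(1 + exp(−x)). For every f ∈ (0,1), φ′(φ⁻¹(f)) = f·(1 − f)·√(1 + (log(f/(1 − f)))²), where φ⁻¹ : (0,1) → ℝ is the inverse of φ, and consequently the ratio φ′(φ⁻¹(f)) / (f·(1 − f)) = √(1 + (log(f/(1 − f)))²) tends to +∞ as f → 1 from below. -/
open Filter

/-- The logit function `f ↦ log (f / (1 - f))` is a left inverse of the sigmoid. -/
theorem Real.log_sigmoid_div_one_sub_sigmoid (x : ℝ) :
    Real.log (Real.sigmoid x / (1 - Real.sigmoid x)) = x := by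
  rw [← Real.sigmoid_neg, ← Real.sigmoid_mul_rexp_neg,
    div_mul_cancel_left₀ (Real.sigmoid_pos x).ne', Real.exp_neg, inv_inv, Real.log_exp]

/-- The logit function tends to `+∞` at `1` from the left. -/
theorem Real.tendsto_log_div_one_sub_nhdsWithin_one :
    Tendsto (fun f : ℝ => Real.log (f / (1 - f))) (nhdsWithin 1 (Set.Ioo 0 1)) atTop := by
  refine Real.tendsto_log_atTop.comp ?_
  have hsub : Tendsto (fun f : ℝ => 1 - f) (nhdsWithin 1 (Set.Ioo 0 1))
      (nhdsWithin 0 (Set.Ioi 0)) := by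
    refine tendsto_nhdsWithin_iff.mpr ⟨tendsto_nhdsWithin_of_tendsto_nhds ?_, ?_⟩
    · exact (continuous_const.sub continuous_id).tendsto' 1 0 (sub_self 1)
    · filter_upwards [self_mem_nhdsWithin] with f hf using sub_pos.mpr hf.2
  have hid : Tendsto (fun f : ℝ => f) (nhdsWithin 1 (Set.Ioo 0 1)) (nhds 1) :=
    tendsto_nhdsWithin_of_tendsto_nhds tendsto_id
  exact hid.pos_mul_atTop one_pos (tendsto_inv_nhdsGT_zero.comp hsub)

/-- For the fast gate φ(z) = σ(sinh z), the learning-speed function satisfies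
g_φ(f) = φ'(φ⁻¹(f)) = f(1-f)√(1 + (log(f/(1-f)))²), so g_φ(f)/(f(1-f)) → ∞ as f → 1⁻. -/
theorem fast_gate_learning_speed
    (σ φ φinv : ℝ → ℝ)
    (hσ : ∀ x, σ x = 1 / (1 + Real.exp (-x)))
    (hφ : ∀ z, φ z = σ (Real.sinh z))
    (hφinv : ∀ z, φinv (φ z) = z)
    (hφinv' : ∀ f ∈ Set.Ioo (0 : ℝ) 1, φ (φinv f) = f) :
    (∀ f ∈ Set.Ioo (0 : ℝ) 1,
      deriv φ (φinv f) =
        f * (1 - f) * Real.sqrt (1 + (Real.log (f / (1 - f))) ^ 2)) ∧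
    Tendsto (fun f => deriv φ (φinv f) / (f * (1 - f)))
      (nhdsWithin 1 (Set.Ioo (0 : ℝ) 1)) atTop := by
  obtain rfl : σ = Real.sigmoid := funext fun x => by rw [hσ, Real.sigmoid_def, one_div]
  obtain rfl : φ = Real.sigmoid ∘ Real.sinh := funext hφ
  have hderiv : ∀ f ∈ Set.Ioo (0 : ℝ) 1,
      deriv (Real.sigmoid ∘ Real.sinh) (φinv f) =
        f * (1 - f) * Real.sqrt (1 + (Real.log (f / (1 - f))) ^ 2) := by
    intro f hf
    have hz : Real.sigmoid (Real.sinh (φinv f)) = f := hφinv' f hf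
    have hlog : Real.log (f / (1 - f)) = Real.sinh (φinv f) := by
      simpa only [hz] using Real.log_sigmoid_div_one_sub_sigmoid (Real.sinh (φinv f))
    rw [((Real.hasDerivAt_sigmoid _).comp (φinv f) (Real.hasDerivAt_sinh _)).deriv, hz, hlog,
      ← Real.cosh_arsinh, Real.arsinh_sinh]
  refine ⟨hderiv, tendsto_atTop_mono' _ ?_ Real.tendsto_log_div_one_sub_nhdsWithin_one⟩
  filter_upwards [self_mem_nhdsWithin] with f hf
  rw [hderiv f hf, mul_div_cancel_left₀ _ (mul_pos hf.1 (sub_pos.mpr hf.2)).ne']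
  exact Real.le_sqrt_of_sq_le (le_add_of_nonneg_left zero_le_one)
end
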